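/- Let k and n be integers with n ≥ k ≥ 1, and let H_1, …, H_q be hyperplanes in P^k over a field F, not necessarily distinct, in n-subgeneral position. Let X = (2n − k + 1, k + 1) ∈ R², and let P_0, …, P_s, X be the vertices, listed in order of increasing x-coordinate, of the lower convex hull of the finite set {(α(L), codim L) : L a nonempty linear subspace of P^k} ∪ {X}. For each j = 0, …, s choose any linear subspace L_j ⊆ P^k with (α(L_j), codim L_j) = P_j. Then L_j ⊇ L_{j+1} for j = 0, …, s − 1; i.e., any such choice of subspaces forms a decreasing chain L_0 ⊇ L_1 ⊇ ⋯ ⊇ L_s. -/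

import Mathlib

open scoped Classical

/-- Distinct hyperplanes `H 0, …, H (q-1)` of `ℙⁿ` (recorded as their affine cones, i.e. as
`n`-dimensional linear subspaces of `F^(n+1)`) are *in general position* if any `m` of them with
`m ≤ n + 1` intersect in a projective linear subspace of codimension `m` (equivalently, their
affine cones intersect in a linear subspace of vector dimension `n + 1 - m`; for `m = n + 1`
the intersection is empty, i.e. the cones meet only at `0`). -/
def InGeneralPosition (F : Type*) [Field F] (n q : ℕ)
    (H : Fin q → Submodule F (Fin (n + 1) → F)) : Prop :=
  Function.Injective H ∧ (∀ i, Module.finrank F (H i) = n) ∧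
    ∀ I : Finset (Fin q), I.card ≤ n + 1 →
      Module.finrank F ↥(⨅ i ∈ I, H i) = n + 1 - I.card

/-- Hyperplanes `H 0, …, H (q-1)` of `ℙᵏ` (as linear subspaces of `F^(k+1)`), not necessarily
distinct, are *in `n`-subgeneral position* if there are a linear embedding `φ` of `ℙᵏ` as a
linear subspace of `ℙⁿ` (i.e. an injective linear map `F^(k+1) →ₗ F^(n+1)`) and distinct
hyperplanes `H' 0, …, H' (q-1)` of `ℙⁿ` in general position with `H i = H' i ∩ ℙᵏ`
(i.e. `H i = (H' i).comap φ`) for all `i`. -/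
def InSubgeneralPosition (F : Type*) [Field F] (k n q : ℕ)
    (H : Fin q → Submodule F (Fin (k + 1) → F)) : Prop :=
  ∃ (φ : (Fin (k + 1) → F) →ₗ[F] (Fin (n + 1) → F))
    (H' : Fin q → Submodule F (Fin (n + 1) → F)),
    Function.Injective φ ∧ InGeneralPosition F n q H' ∧
    ∀ i, H i = (H' i).comap φ

/-- The point of the chord from `p` to `r` above an abscissa strictly between theirs. -/
lemma chord_mem_openSegment {p r : ℝ × ℝ} {x : ℝ} (hp : p.1 < x) (hr : x < r.1) :
    (x, ((r.1 - x) * p.2 + (x - p.1) * r.2) / (r.1 - p.1)) ∈ openSegment ℝ p r := by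
  have h : 0 < r.1 - p.1 := by linarith
  refine ⟨(r.1 - x) / (r.1 - p.1), (x - p.1) / (r.1 - p.1), div_pos (by linarith) h,
    div_pos (by linarith) h, ?_, ?_⟩
  · field_simp
    ring
  · ext
    · simp only [Prod.fst_add, Prod.smul_fst, smul_eq_mul]
      field_simp
      ring
    · simp only [Prod.snd_add, Prod.smul_snd, smul_eq_mul]
      field_simp

/-- An extreme point is not strictly between two points of the set on a common line. -/
lemma not_collinear_of_mem_extremePoints {C : Set (ℝ × ℝ)} {p v r : ℝ × ℝ} {m c : ℝ}
    (hv : v ∈ C.extremePoints ℝ) (hp : p ∈ C) (hr : r ∈ C) (hpv : p.1 < v.1) (hvr : v.1 < r.1)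
    (ep : p.2 = m * p.1 + c) (ev : v.2 = m * v.1 + c) : r.2 ≠ m * r.1 + c := by
  intro er
  have h : r.1 - p.1 ≠ 0 := by linarith
  have hseg := chord_mem_openSegment hpv hvr
  have : (v.1, ((r.1 - v.1) * p.2 + (v.1 - p.1) * r.2) / (r.1 - p.1)) = v := by
    ext
    · rfl
    · simp only [ep, ev, er]
      field_simp
      ring
  rw [this] at hseg
  have := (mem_extremePoints.1 hv).2 p hp r hr hseg
  rw [this.1] at hpv
  exact lt_irrefl _ hpv

/-- Points strictly below a line through a point `v` of the lower boundary lie on one side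
of `v`: no chord from a point strictly below the line to a point on it passes over `v`. -/
lemma not_below_chord {C : Set (ℝ × ℝ)} (hC : Convex ℝ C) {p v r : ℝ × ℝ} {m c : ℝ}
    (hv : ∀ y < v.2, (v.1, y) ∉ C) (hp : p ∈ C) (hr : r ∈ C) (hpv : p.1 < v.1) (hvr : v.1 < r.1)
    (ep : p.2 ≤ m * p.1 + c) (er : r.2 ≤ m * r.1 + c)
    (hlt : p.2 < m * p.1 + c ∨ r.2 < m * r.1 + c) : v.2 ≠ m * v.1 + c := by
  intro ev
  have h : 0 < r.1 - p.1 := by linarith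
  refine hv _ ?_ (hC.openSegment_subset hp hr (chord_mem_openSegment hpv hvr))
  rw [div_lt_iff₀ h, ev]
  rcases hlt with hlt | hlt
  · nlinarith [mul_pos (sub_pos.2 hvr) (sub_pos.2 hlt),
      mul_nonneg (sub_pos.2 hpv).le (sub_nonneg.2 er)]
  · nlinarith [mul_nonneg (sub_pos.2 hvr).le (sub_nonneg.2 ep),
      mul_pos (sub_pos.2 hpv) (sub_pos.2 hlt)]

/-- The line through two consecutive vertices of the lower boundary of a compact convex set
supports the set from below. -/
lemma line_le_of_consecutive {C : Set (ℝ × ℝ)} (hcpt : IsCompact C) (hC : Convex ℝ C)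
    {A B : ℝ × ℝ} (hAB : A.1 < B.1) (hA : A ∈ C) (hB : B ∈ C)
    (hAlow : ∀ y < A.2, (A.1, y) ∉ C) (hBlow : ∀ y < B.2, (B.1, y) ∉ C)
    (hcons : ∀ V ∈ C.extremePoints ℝ, (∀ y < V.2, (V.1, y) ∉ C) → V.1 ≤ A.1 ∨ B.1 ≤ V.1)
    {m c : ℝ} (eA : A.2 = m * A.1 + c) (eB : B.2 = m * B.1 + c) :
    ∀ p ∈ C, m * p.1 + c ≤ p.2 := by
  intro p hp
  by_contra! hlt
  let f : ℝ × ℝ →L[ℝ] ℝ := m • ContinuousLinearMap.fst ℝ ℝ ℝ - ContinuousLinearMap.snd ℝ ℝ ℝ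
  have hf : ∀ v, f v = m * v.1 - v.2 := fun v => by simp [f]
  have hexp : IsExposed ℝ C (f.toExposed C) := ContinuousLinearMap.toExposed.isExposed
  obtain ⟨w, hw, hmax⟩ := hcpt.exists_isMaxOn ⟨p, hp⟩ f.continuous.continuousOn
  obtain ⟨V, hV⟩ := (hexp.isCompact hcpt).extremePoints_nonempty ⟨w, hw, hmax⟩
  have hVmax : ∀ y ∈ C, f y ≤ f V := (extremePoints_subset hV).2
  have hVC : V ∈ C := (extremePoints_subset hV).1
  have hVext := hexp.isExtreme.extremePoints_subset_extremePoints hV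
  have hVlow : ∀ y < V.2, (V.1, y) ∉ C := fun y hy hmem => by
    have := hVmax _ hmem
    rw [hf, hf] at this
    dsimp only at this
    linarith
  have hVlt : V.2 < m * V.1 + c := by
    have := hVmax p hp
    rw [hf, hf] at this
    linarith
  rcases hcons V hVext hVlow with h | h
  · rcases h.lt_or_eq with h | h
    · exact not_below_chord hC hAlow hVC hB h hAB hVlt.le eB.le (.inl hVlt) eA
    · exact hAlow V.2 (by rw [eA, ← h]; exact hVlt) (by rw [← h]; exact hVC)
  · rcases h.lt_or_eq with h | h
    · exact not_below_chord hC hBlow hA hVC hAB h eA.le hVlt.le (.inr hVlt) eB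
    · exact hBlow V.2 (by rw [eB, h]; exact hVlt) (by rw [h]; exact hVC)

/-- A nonempty linear subspace lies in few hyperplanes in subgeneral position. -/
lemma InSubgeneralPosition.card_add_finrank_le {F : Type*} [Field F] {k n q : ℕ}
    {H : Fin q → Submodule F (Fin (k + 1) → F)} (hpos : InSubgeneralPosition F k n q H)
    {L : Submodule F (Fin (k + 1) → F)} (hL : L ≠ ⊥) :
    (Finset.univ.filter fun i => L ≤ H i).card + Module.finrank F L ≤ n + 1 := by
  obtain ⟨φ, H', hφ, ⟨-, -, hgen⟩, hH⟩ := hpos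
  have key : ∀ I ⊆ Finset.univ.filter fun i => L ≤ H i, I.card ≤ n + 1 →
      Module.finrank F L ≤ n + 1 - I.card := by
    intro I hI hcard
    rw [← hgen I hcard, (Submodule.equivMapOfInjective φ hφ L).finrank_eq]
    refine Submodule.finrank_mono (le_iInf₂ fun i hi => ?_)
    rw [Submodule.map_le_iff_le_comap, ← hH]
    exact (Finset.mem_filter.1 (hI hi)).2
  have hLpos : 0 < Module.finrank F L :=
    Nat.pos_of_ne_zero fun h => hL (Submodule.finrank_eq_zero.1 h)
  rcases le_or_gt (Finset.univ.filter fun i => L ≤ H i).card (n + 1) with h | h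
  · have := key _ subset_rfl h
    omega
  · obtain ⟨I, hI, hc⟩ := Finset.exists_subset_card_eq h.le
    have := key I hI hc.le
    omega

/-- The number of hyperplanes containing a subspace is supermodular. -/
lemma card_add_card_le_card_sup_add_card_inf {F V ι : Type*} [Field F] [AddCommGroup V]
    [Module F V] [Fintype ι] (H : ι → Submodule F V) (L M : Submodule F V) :
    (Finset.univ.filter fun i => L ≤ H i).card + (Finset.univ.filter fun i => M ≤ H i).card ≤
      (Finset.univ.filter fun i => L ⊔ M ≤ H i).card +
        (Finset.univ.filter fun i => L ⊓ M ≤ H i).card := by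
  rw [← Finset.card_inter_add_card_union]
  refine add_le_add (Finset.card_le_card fun i => ?_) (Finset.card_le_card fun i => ?_)
  · simp
  · simp only [Finset.mem_union, Finset.mem_filter, Finset.mem_univ, true_and]
    rintro (h | h)
    exacts [inf_le_left.trans h, inf_le_right.trans h]

/-- **The chain lemma for the Nochka diagram.**  Linear subspaces of `ℙᵏ` are recorded as their
affine cones in `F^(k+1)` (nonempty means `≠ ⊥`); for such an `L` set
`α(L) = #{i : H i ⊇ L}` and `codim L = (k + 1) - finrank L`, and `P(L) = (α L, codim L) ∈ ℝ²`.
Let `X = (2n - k + 1, k + 1)`, let `T = {P(L) : L ≠ ⊥} ∪ {X}`, and let `P 0, …, P s, X` be the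
vertices of the lower convex hull of `T` in order of increasing x-coordinate (formally: the
extreme points of `convexHull ℝ T` lying on its lower boundary — i.e. those points of the hull
having no point of the hull strictly below them — form exactly the set `{P 0, …, P s, X}`, the
x-coordinates of `P 0, …, P s` are strictly increasing, and all are less than that of `X`).
If for each `j` the subspace `L j` is any nonempty linear subspace with `P(L j) = P j`, then
`L 0 ⊇ L 1 ⊇ ⋯ ⊇ L s`. -/
theorem nochka_chain (F : Type*) [Field F] (k n q : ℕ) (hk : 1 ≤ k) (hkn : k ≤ n)
    (H : Fin q → Submodule F (Fin (k + 1) → F))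
    (hHhyp : ∀ i, Module.finrank F (H i) = k)
    (hpos : InSubgeneralPosition F k n q H)
    (X : ℝ × ℝ) (hX : X = (2 * (n : ℝ) - k + 1, (k : ℝ) + 1))
    (T : Set (ℝ × ℝ))
    (hT : T = {p : ℝ × ℝ | ∃ L : Submodule F (Fin (k + 1) → F), L ≠ ⊥ ∧
        p = (((Finset.univ.filter fun i => L ≤ H i).card : ℝ),
             (k : ℝ) + 1 - Module.finrank F L)} ∪ {X})
    (s : ℕ) (P : Fin (s + 1) → ℝ × ℝ)
    (hvert : (convexHull ℝ T).extremePoints ℝ ∩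
        {p | p ∈ convexHull ℝ T ∧ ∀ y : ℝ, y < p.2 → (p.1, y) ∉ convexHull ℝ T}
      = Set.range P ∪ {X})
    (hmono : ∀ j j' : Fin (s + 1), j < j' → (P j).1 < (P j').1)
    (hlastX : ∀ j, (P j).1 < X.1)
    (L : Fin (s + 1) → Submodule F (Fin (k + 1) → F))
    (hL : ∀ j, L j ≠ ⊥ ∧
      P j = (((Finset.univ.filter fun i => L j ≤ H i).card : ℝ),
             (k : ℝ) + 1 - Module.finrank F (L j))) :
    ∀ j : Fin s, L j.succ ≤ L j.castSucc := by
  intro j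
  set α : Submodule F (Fin (k + 1) → F) → ℕ :=
    fun N => (Finset.univ.filter fun i => N ≤ H i).card with hα
  set C := convexHull ℝ T with hCdef
  have hTC : T ⊆ C := subset_convexHull ℝ T
  have hfin : T.Finite := by
    rw [hT]
    refine Set.Finite.union (Set.Finite.subset (Set.Finite.image
      (fun a : ℕ × ℕ => ((a.1 : ℝ), (k : ℝ) + 1 - a.2))
      ((Set.finite_Iic q).prod (Set.finite_Iic (k + 1)))) ?_) (Set.finite_singleton _)
    rintro p ⟨N, -, rfl⟩
    refine ⟨(α N, Module.finrank F N), ⟨?_, ?_⟩, rfl⟩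
    · simpa using Finset.card_le_univ (Finset.univ.filter fun i => N ≤ H i)
    · simpa using Submodule.finrank_le N
  have hmemT : ∀ N : Submodule F (Fin (k + 1) → F), N ≠ ⊥ →
      ((α N : ℝ), (k : ℝ) + 1 - Module.finrank F N) ∈ C := fun N hN =>
    hTC (by rw [hT]; exact .inl ⟨N, hN, rfl⟩)
  have hXC : X ∈ C := hTC (by rw [hT]; exact .inr rfl)
  have hP : ∀ i, P i ∈ C.extremePoints ℝ ∧ ∀ y < (P i).2, ((P i).1, y) ∉ C := fun i => by
    have : P i ∈ Set.range P ∪ {X} := .inl ⟨i, rfl⟩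
    rw [← hvert] at this
    exact ⟨this.1, this.2.2⟩
  set A := P j.castSucc
  set B := P j.succ
  have hAB : A.1 < B.1 := hmono _ _ j.castSucc_lt_succ
  have hBX : B.1 < X.1 := hlastX _
  obtain ⟨m, c, eA, eB⟩ : ∃ m c : ℝ, A.2 = m * A.1 + c ∧ B.2 = m * B.1 + c := by
    have h : B.1 - A.1 ≠ 0 := by linarith
    refine ⟨(B.2 - A.2) / (B.1 - A.1), A.2 - (B.2 - A.2) / (B.1 - A.1) * A.1, by ring, ?_⟩
    field_simp
    ring
  have hAext := (hP j.castSucc).1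
  have hBext := (hP j.succ).1
  have hAC : A ∈ C := extremePoints_subset hAext
  have hBC : B ∈ C := extremePoints_subset hBext
  have hsupp : ∀ p ∈ C, m * p.1 + c ≤ p.2 := by
    refine line_le_of_consecutive (hfin.isCompact_convexHull (𝕜 := ℝ)) (convex_convexHull ℝ T) hAB
      hAC hBC (hP j.castSucc).2 (hP j.succ).2 (fun V hV hlow => ?_) eA eB
    have hVmem : V ∈ Set.range P ∪ {X} := by
      rw [← hvert]
      exact ⟨hV, extremePoints_subset hV, hlow⟩
    rcases hVmem with ⟨i, rfl⟩ | rfl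
    · rcases le_or_gt i j.castSucc with h | h
      · exact .inl (StrictMono.monotone (fun _ _ => hmono _ _) h)
      · exact .inr (StrictMono.monotone (fun _ _ => hmono _ _)
          (Fin.castSucc_lt_iff_succ_le.1 h))
    · exact .inr hBX.le
  have hXlt : m * X.1 + c < X.2 := lt_of_le_of_ne (hsupp X hXC) fun h =>
    not_collinear_of_mem_extremePoints hBext hAC hXC hAB hBX eA eB h.symm
  obtain ⟨hLne, hA⟩ := hL j.castSucc
  obtain ⟨hMne, hB⟩ := hL j.succ
  change A = _ at hA
  change B = _ at hB
  set N := L j.castSucc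
  set M := L j.succ
  have hc : c ≤ 0 := by
    have htop : α ⊤ = 0 := by
      simp only [hα, Finset.card_eq_zero, Finset.filter_eq_empty_iff]
      intro i _ hi
      have := hHhyp i
      rw [top_le_iff.1 hi, finrank_top, Module.finrank_fin_fun] at this
      omega
    have := hsupp _ (hmemT ⊤ top_ne_bot)
    simpa [htop, finrank_top] using this
  have hdim : (Module.finrank F ↥(N ⊔ M) : ℝ) + Module.finrank F ↥(N ⊓ M) =
      Module.finrank F N + Module.finrank F M := by
    exact_mod_cast Submodule.finrank_sup_add_finrank_inf_eq N M
  have hcard : (α N : ℝ) + α M ≤ α (N ⊔ M) + α (N ⊓ M) := by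
    exact_mod_cast card_add_card_le_card_sup_add_card_inf H N M
  have hbN : (α N : ℝ) + Module.finrank F N ≤ n + 1 := by
    exact_mod_cast hpos.card_add_finrank_le hLne
  have hbM : (α M : ℝ) + Module.finrank F M ≤ n + 1 := by
    exact_mod_cast hpos.card_add_finrank_le hMne
  have hMpos : (0 : ℝ) < Module.finrank F M := by
    exact_mod_cast Nat.pos_of_ne_zero fun h => hMne (Submodule.finrank_eq_zero.1 h)
  have hdimle : ∀ K : Submodule F (Fin (k + 1) → F), (Module.finrank F K : ℝ) ≤ k + 1 := by
    intro K
    exact_mod_cast (Submodule.finrank_le K).trans_eq (Module.finrank_fin_fun F)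
  have eA1 : A.1 = α N := by rw [hA]
  have eA2 : A.2 = k + 1 - Module.finrank F N := by rw [hA]
  have eB1 : B.1 = α M := by rw [hB]
  have eB2 : B.2 = k + 1 - Module.finrank F M := by rw [hB]
  have hA0 : (0 : ℝ) ≤ α N := Nat.cast_nonneg _
  have hkn' : (k : ℝ) ≤ n := by exact_mod_cast hkn
  have hm : 0 ≤ m := by
    by_contra! hneg
    have := hdimle M
    have := mul_pos_of_neg_of_neg hneg (show -B.1 < 0 by linarith)
    linarith
  have hX1 : X.1 = 2 * (n : ℝ) - k + 1 := by rw [hX]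
  have hX2 : X.2 = (k : ℝ) + 1 := by rw [hX]
  rw [eA1, eA2] at eA
  rw [eB1, eB2] at eB
  rw [hX1, hX2] at hXlt
  have hsup_ne : N ⊔ M ≠ ⊥ := fun h => hMne (le_bot_iff.1 (h ▸ le_sup_right))
  have hsup := hsupp _ (hmemT _ hsup_ne)
  dsimp only at hsup
  by_cases hbot : N ⊓ M = ⊥
  · exfalso
    have h0 : (Module.finrank F ↥(N ⊓ M) : ℝ) = 0 := by rw [hbot]; simp
    have hz := hdimle (N ⊔ M)
    have hm1 : m < 1 := by
      by_contra! h1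
      have := mul_le_mul_of_nonneg_right h1
        (show (0 : ℝ) ≤ 2 * (n : ℝ) - k + 1 - α M by linarith)
      linarith
    have h1 := mul_le_mul_of_nonneg_left (add_le_add hbN hbM) hm
    have h2 := mul_nonneg (sub_nonneg.2 hm1.le) (sub_nonneg.2 hz)
    have hS : (Module.finrank F ↥(N ⊔ M) : ℝ) = Module.finrank F N + Module.finrank F M := by
      linarith
    rw [hS] at h2
    linarith
  · have hinf := hsupp _ (hmemT _ hbot)
    dsimp only at hinf
    have h1 := mul_le_mul_of_nonneg_left hcard hm
    have hsupeq : (k : ℝ) + 1 - Module.finrank F ↥(N ⊔ M) = m * α (N ⊔ M) + c := by linarith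
    have hle : (α (N ⊔ M) : ℝ) ≤ α N := by
      exact_mod_cast Finset.card_le_card fun i => by
        simp only [Finset.mem_filter, Finset.mem_univ, true_and]
        exact le_sup_left.trans
    have heq : (α (N ⊔ M) : ℝ) = α N := by
      refine hle.eq_of_not_lt fun hlt => ?_
      refine not_collinear_of_mem_extremePoints hAext (hmemT _ hsup_ne) hBC
        (by rw [eA1]; exact hlt) hAB hsupeq (by rw [eA1, eA2]; exact eA)
        (by rw [eB1, eB2]; exact eB)
    rw [heq] at hsupeq
    have hrank : Module.finrank F N = Module.finrank F ↥(N ⊔ M) := by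
      have : (Module.finrank F N : ℝ) = Module.finrank F ↥(N ⊔ M) := by linarith
      exact_mod_cast this
    have hNM := Submodule.eq_of_le_of_finrank_eq (le_sup_left : N ≤ N ⊔ M) hrank
    rw [hNM]
    exact le_sup_right
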